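/- Let σ be a gauge field on 𝒢 and let G^db_σ be the Green's function of the double cover 𝒢^db_σ with zero boundary conditions on V^db_∂ (the inverse of the V^db_int×V^db_int matrix of −Δ^db_σ). Then for all x,y∈V_int, writing x_1=(x,0), y_1=(y,0), y_2=(y,1): G^db_σ(x_1,y_1) = (1/2)(G(x,y)+G_σ(x,y)) and G^db_σ(x_1,y_2) = (1/2)(G(x,y)−G_σ(x,y)); equivalently G(x,y)=G^db_σ(x_1,y_1)+G^db_σ(x_1,y_2) and G_σ(x,y)=G^db_σ(x_1,y_1)−G^db_σ(x_1,y_2). -/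

import Mathlib

open scoped Classical

/-- The double cover `𝒢^db_σ` of `G` induced by the gauge field `σ`: its vertex set is
`V × Bool`, an edge `{x,y}` of `G` with `σ(x,y) = 1` lifts to the two parallel edges
`{(x,i),(y,i)}`, and an edge with `σ(x,y) = −1` lifts to the two crossing edges
`{(x,i),(y,!i)}`. -/
def doubleCover {V : Type*} (G : SimpleGraph V) (σ : V → V → ℝ)
    (hσsym : ∀ x y, σ x y = σ y x) : SimpleGraph (V × Bool) where
  Adj p q := G.Adj p.1 q.1 ∧ (p.2 = q.2 ↔ σ p.1 q.1 = 1)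
  symm := by
    constructor
    rintro ⟨x, i⟩ ⟨y, j⟩ ⟨h1, h2⟩
    refine ⟨h1.symm, ?_⟩
    rw [hσsym y x]
    exact ⟨fun h => h2.mp h.symm, fun h => (h2.mpr h).symm⟩
  loopless := by
    constructor
    rintro ⟨x, i⟩ ⟨h1, _⟩
    exact G.loopless.irrefl x h1

/-- The interior matrix of `−Δ_{H,σ}` (diagonal `W(x) = Σ_{z∼x} C(x,z)`, off-diagonal
`−σ(x,y)C(x,y)` for adjacent interior `x,y`). -/
noncomputable def minusTwistedLapMatrix {α : Type*} [Fintype α] (H : SimpleGraph α)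
    (C σ : α → α → ℝ) (int : Finset α) : Matrix int int ℝ :=
  Matrix.of fun x y : int =>
    if (x : α) = (y : α) then ∑ z : α, (if H.Adj (x : α) z then C (x : α) z else 0)
    else if H.Adj (x : α) (y : α) then -(σ (x : α) (y : α) * C (x : α) (y : α)) else 0

/-- The `σ`-twisted Green's function with zero boundary conditions. -/
noncomputable def twistedGreen {α : Type*} [Fintype α] (H : SimpleGraph α)
    (C σ : α → α → ℝ) (int : Finset α) : Matrix int int ℝ :=
  (minusTwistedLapMatrix H C σ int)⁻¹

/-- The (untwisted) Green's function of the double cover `𝒢^db_σ`, with zero boundary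
conditions on `V^db_∂ = V_∂ × {0,1}`: the inverse of the interior matrix of minus its
graph Laplacian, the conductances being `C((x,i),(y,j)) = C(x,y)`. -/
noncomputable def greenDb {V : Type*} [Fintype V] (G : SimpleGraph V)
    (σ : V → V → ℝ) (hσsym : ∀ x y, σ x y = σ y x) (C : V → V → ℝ)
    (Vi : Finset V) :
    Matrix ↥(Vi ×ˢ (Finset.univ : Finset Bool)) ↥(Vi ×ˢ (Finset.univ : Finset Bool)) ℝ :=
  twistedGreen (doubleCover G σ hσsym) (fun a b => C a.1 b.1) (fun _ _ => 1)
    (Vi ×ˢ (Finset.univ : Finset Bool))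

lemma mtl_apply {α : Type*} [Fintype α] (H : SimpleGraph α)
    (C σ : α → α → ℝ) (int : Finset α) (x y : int) :
    minusTwistedLapMatrix H C σ int x y =
      (if x = y then ∑ z : α, (if H.Adj (x : α) z then C (x : α) z else 0) else 0)
        - (if H.Adj (x : α) (y : α) then σ (x : α) (y : α) * C (x : α) (y : α) else 0) := by
  unfold minusTwistedLapMatrix
  by_cases h : x = y
  · subst h
    simp
  · have h' : (x : α) ≠ y := fun e => h (Subtype.ext e)
    simp only [Matrix.of_apply, h, h', if_false]
    split_ifs <;> simp

lemma twistedGreen_eq {α : Type*} [Fintype α] (H : SimpleGraph α)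
    (C σ : α → α → ℝ) (int : Finset α) (M : Matrix int int ℝ)
    (h : ∀ p q, (minusTwistedLapMatrix H C σ int * M) p q = if p = q then 1 else 0) :
    twistedGreen H C σ int = M := by
  unfold twistedGreen
  apply Matrix.inv_eq_right_inv
  ext p q
  rw [h, Matrix.one_apply]

lemma mtl_det {V : Type*} [Fintype V]
    (G : SimpleGraph V) (hconn : G.Connected)
    (Vi : Finset V) (hVb : ∃ b, b ∉ Vi)
    (C : V → V → ℝ) (hCsym : ∀ x y, C x y = C y x)
    (hCpos : ∀ x y, G.Adj x y → 0 < C x y)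
    (σ : V → V → ℝ) (hσsym : ∀ x y, σ x y = σ y x)
    (hσpm : ∀ x y, G.Adj x y → σ x y = 1 ∨ σ x y = -1) :
    IsUnit (minusTwistedLapMatrix G C σ Vi).det := by
  rw [isUnit_iff_ne_zero]
  intro hdet
  obtain ⟨v, hv0, hv⟩ := Matrix.exists_mulVec_eq_zero_iff.mpr hdet
  apply hv0
  let f : V → ℝ := fun x => if h : x ∈ Vi then v ⟨x, h⟩ else 0
  have hfv : ∀ x : Vi, f x = v x := fun x => by simp [f]
  have hf0 : ∀ x, x ∉ Vi → f x = 0 := fun x hx => by simp [f, hx]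
  let T : V → V → ℝ := fun x z => if G.Adj x z then C x z * (f x - σ x z * f z) else 0
  have hT : ∀ x, f x * ∑ z, T x z = 0 := by
    intro x
    by_cases hx : x ∈ Vi
    · have h1 := congrFun hv ⟨x, hx⟩
      simp only [Matrix.mulVec, dotProduct, mtl_apply, sub_mul, Finset.sum_sub_distrib, ite_mul,
        zero_mul, Finset.sum_ite_eq, Finset.mem_univ, if_true, Pi.zero_apply] at h1
      have h2 : ∑ y : Vi, (if G.Adj x y then σ x y * C x y * v y else 0)
          = ∑ z, (if G.Adj x z then σ x z * C x z * f z else 0) := by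
        rw [← Finset.sum_subset (Finset.subset_univ Vi)
          (f := fun z => if G.Adj x z then σ x z * C x z * f z else 0),
          ← Finset.sum_coe_sort Vi]
        · exact Finset.sum_congr rfl fun y _ => by rw [hfv]
        · intro z _ hz
          simp [hf0 z hz]
      rw [h2, ← hfv, Finset.sum_mul, ← Finset.sum_sub_distrib] at h1
      have h3 : ∑ z, T x z = 0 := by
        rw [← h1]
        refine Finset.sum_congr rfl fun z _ => ?_
        simp only [T]
        split_ifs <;> ring
      rw [h3, mul_zero]
    · rw [hf0 x hx, zero_mul]
  have hE : ∑ x, ∑ z, (f x * T x z + f z * T z x) = 0 := by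
    simp only [Finset.sum_add_distrib]
    rw [Finset.sum_comm (f := fun x z => f z * T z x)]
    simp only [← Finset.mul_sum, hT, Finset.sum_const_zero, add_zero]
  have hsq : ∀ x z, f x * T x z + f z * T z x
      = if G.Adj x z then C x z * (f x - σ x z * f z) ^ 2 else 0 := by
    intro x z
    simp only [T, G.adj_comm z x, hCsym z x, hσsym z x]
    split_ifs with h
    · rcases hσpm x z h with h | h <;> rw [h] <;> ring
    · ring
  simp only [hsq] at hE
  have hnn : ∀ x z, 0 ≤ (if G.Adj x z then C x z * (f x - σ x z * f z) ^ 2 else 0) := by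
    intro x z
    split_ifs with h
    · exact mul_nonneg (hCpos x z h).le (sq_nonneg _)
    · exact le_rfl
  have hedge : ∀ x z, G.Adj x z → f x = σ x z * f z := by
    intro x z h
    have h1 := (Finset.sum_eq_zero_iff_of_nonneg
      (fun x _ => Finset.sum_nonneg fun z _ => hnn x z)).mp hE x (Finset.mem_univ _)
    have h2 := (Finset.sum_eq_zero_iff_of_nonneg (fun z _ => hnn x z)).mp h1 z (Finset.mem_univ _)
    rw [if_pos h] at h2
    have h3 := (mul_eq_zero.mp h2).resolve_left (hCpos x z h).ne'
    exact sub_eq_zero.mp (pow_eq_zero_iff two_ne_zero |>.mp h3)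
  obtain ⟨b, hb⟩ := hVb
  have hall : ∀ x, f x = 0 := by
    intro x
    obtain ⟨w⟩ := hconn.preconnected x b
    have key : ∀ {x y : V}, G.Walk x y → f y = 0 → f x = 0 := by
      intro x y w
      induction w with
      | nil => exact id
      | cons h p ih => intro h0; rw [hedge _ _ h, ih h0, mul_zero]
    exact key w (hf0 b hb)
  funext x
  rw [← hfv, hall]
  rfl

/-- The sign `s(i,j)`, equal to `1` when the sheets agree and `-1` otherwise. -/
noncomputable def sheetSign (i j : Bool) : ℝ := if i = j then 1 else -1

/-- Identification of the interior of the double cover with `V_int × Bool`. -/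
def intEquiv {V : Type*} (Vi : Finset V) :
    (Vi × Bool) ≃ ↥(Vi ×ˢ (Finset.univ : Finset Bool)) where
  toFun p := ⟨(p.1, p.2), Finset.mem_product.mpr ⟨p.1.2, Finset.mem_univ _⟩⟩
  invFun q := (⟨q.1.1, (Finset.mem_product.mp q.2).1⟩, q.1.2)
  left_inv _ := rfl
  right_inv _ := rfl

lemma db_apply {V : Type*} [Fintype V]
    (G : SimpleGraph V) (Vi : Finset V) (C : V → V → ℝ)
    (σ : V → V → ℝ) (hσsym : ∀ x y, σ x y = σ y x)
    (hσpm : ∀ x y, G.Adj x y → σ x y = 1 ∨ σ x y = -1) (x y : Vi) (i j : Bool) :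
    minusTwistedLapMatrix (doubleCover G σ hσsym) (fun a b => C a.1 b.1) (fun _ _ => 1)
      (Vi ×ˢ (Finset.univ : Finset Bool)) (intEquiv Vi (x, i)) (intEquiv Vi (y, j)) =
    (1 / 2) * (minusTwistedLapMatrix G C (fun _ _ => 1) Vi x y
      + sheetSign i j * minusTwistedLapMatrix G C σ Vi x y) := by
  have hW : ∑ z : V × Bool, (if (doubleCover G σ hσsym).Adj (x, i) z then C x z.1 else 0)
      = ∑ z : V, (if G.Adj x z then C x z else 0) := by
    rw [Fintype.sum_prod_type]
    refine Finset.sum_congr rfl fun z _ => ?_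
    by_cases h : G.Adj x z
    · rcases hσpm x z h with h' | h' <;> cases i <;> norm_num [doubleCover, h, h']
    · simp [doubleCover, h]
  simp only [mtl_apply, EmbeddingLike.apply_eq_iff_eq, Prod.mk.injEq]
  have e1 : ((intEquiv Vi (x, i) : _) : V × Bool) = ((x : V), i) := rfl
  have e2 : ((intEquiv Vi (y, j) : _) : V × Bool) = ((y : V), j) := rfl
  rw [e1, e2, hW]
  generalize (∑ z : V, (if G.Adj x z then C x z else 0)) = W
  by_cases hxy : x = y
  · subst hxy
    by_cases hij : i = j <;> simp [doubleCover, sheetSign, hij] <;> ring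
  · by_cases h : G.Adj x y
    · rcases hσpm x y h with h' | h' <;> by_cases hij : i = j <;>
        norm_num [doubleCover, h, h', hij, sheetSign, hxy] <;> ring
    · simp [doubleCover, h, hxy]

lemma greenDb_apply {V : Type*} [Fintype V]
    (G : SimpleGraph V) (hconn : G.Connected)
    (Vi : Finset V) (hVb : ∃ b, b ∉ Vi)
    (C : V → V → ℝ) (hCsym : ∀ x y, C x y = C y x)
    (hCpos : ∀ x y, G.Adj x y → 0 < C x y)
    (σ : V → V → ℝ) (hσsym : ∀ x y, σ x y = σ y x)
    (hσpm : ∀ x y, G.Adj x y → σ x y = 1 ∨ σ x y = -1) (x y : Vi) (i j : Bool) :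
    greenDb G σ hσsym C Vi (intEquiv Vi (x, i)) (intEquiv Vi (y, j)) =
      (1 / 2) * (twistedGreen G C (fun _ _ => 1) Vi x y
        + sheetSign i j * twistedGreen G C σ Vi x y) := by
  have hA := Matrix.mul_nonsing_inv _ (mtl_det G hconn Vi hVb C hCsym hCpos (fun _ _ => 1)
    (fun _ _ => rfl) (fun _ _ _ => Or.inl rfl))
  have hB := Matrix.mul_nonsing_inv _ (mtl_det G hconn Vi hVb C hCsym hCpos σ hσsym hσpm)
  let M : Matrix ↥(Vi ×ˢ (Finset.univ : Finset Bool)) ↥(Vi ×ˢ (Finset.univ : Finset Bool)) ℝ :=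
    fun p q => (1 / 2) * (twistedGreen G C (fun _ _ => 1) Vi ((intEquiv Vi).symm p).1
        ((intEquiv Vi).symm q).1 + sheetSign p.1.2 q.1.2 * twistedGreen G C σ Vi
        ((intEquiv Vi).symm p).1 ((intEquiv Vi).symm q).1)
  suffices h : greenDb G σ hσsym C Vi = M by rw [h]; rfl
  unfold greenDb
  apply twistedGreen_eq
  intro p q
  obtain ⟨⟨a, k⟩, rfl⟩ := (intEquiv Vi).surjective p
  obtain ⟨⟨b, l⟩, rfl⟩ := (intEquiv Vi).surjective q
  have hA' := congrFun (congrFun hA a) b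
  have hB' := congrFun (congrFun hB a) b
  rw [Matrix.mul_apply] at hA' hB' ⊢
  rw [← (intEquiv Vi).sum_comp, Fintype.sum_prod_type]
  simp only [db_apply G Vi C σ hσsym hσpm]
  have hM : ∀ c m, M (intEquiv Vi (c, m)) (intEquiv Vi (b, l)) =
    (1 / 2) * (twistedGreen G C (fun _ _ => 1) Vi c b
        + sheetSign m l * twistedGreen G C σ Vi c b) := fun _ _ => rfl
  simp only [hM]
  unfold twistedGreen
  have hs : ∀ c : Vi, ∑ m : Bool, (1 / 2) * (minusTwistedLapMatrix G C (fun _ _ => 1) Vi a c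
      + sheetSign k m * minusTwistedLapMatrix G C σ Vi a c) *
      ((1 / 2) * ((minusTwistedLapMatrix G C (fun _ _ => 1) Vi)⁻¹ c b
        + sheetSign m l * (minusTwistedLapMatrix G C σ Vi)⁻¹ c b)) =
      (1 / 2) * (minusTwistedLapMatrix G C (fun _ _ => 1) Vi a c *
        (minusTwistedLapMatrix G C (fun _ _ => 1) Vi)⁻¹ c b) +
      (1 / 2) * sheetSign k l * (minusTwistedLapMatrix G C σ Vi a c *
        (minusTwistedLapMatrix G C σ Vi)⁻¹ c b) := by
    intro c
    cases k <;> cases l <;> simp [sheetSign] <;> ring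
  rw [Finset.sum_congr rfl fun c _ => hs c, Finset.sum_add_distrib, ← Finset.mul_sum,
    ← Finset.mul_sum, hA', hB']
  simp only [Matrix.one_apply, EmbeddingLike.apply_eq_iff_eq, Prod.mk.injEq]
  by_cases hab : a = b <;> by_cases hkl : k = l <;> norm_num [sheetSign, hab, hkl]

/-- The Green's function of the double cover determines, and is determined by, the pair
of Green's functions of the base graph: `G^db_σ(x₁,y₁) = (G(x,y)+G_σ(x,y))/2` and
`G^db_σ(x₁,y₂) = (G(x,y)−G_σ(x,y))/2`, where `x₁ = (x,0)`, `y₁ = (y,0)`, `y₂ = (y,1)`. -/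
theorem greenDb_eq_half_sum_diff {V : Type*} [Fintype V] [DecidableEq V]
    (G : SimpleGraph V) (hconn : G.Connected)
    (Vi : Finset V) (hVi : Vi.Nonempty) (hVb : (Viᶜ : Finset V).Nonempty)
    (C : V → V → ℝ) (hCsym : ∀ x y, C x y = C y x)
    (hCpos : ∀ x y, G.Adj x y → 0 < C x y)
    (σ : V → V → ℝ) (hσsym : ∀ x y, σ x y = σ y x)
    (hσpm : ∀ x y, G.Adj x y → σ x y = 1 ∨ σ x y = -1) :
    ∀ (x y : V) (hx : x ∈ Vi) (hy : y ∈ Vi),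
      greenDb G σ hσsym C Vi
          ⟨(x, false), Finset.mem_product.mpr ⟨hx, Finset.mem_univ _⟩⟩
          ⟨(y, false), Finset.mem_product.mpr ⟨hy, Finset.mem_univ _⟩⟩ =
        (1 / 2) * (twistedGreen G C (fun _ _ => 1) Vi ⟨x, hx⟩ ⟨y, hy⟩ +
          twistedGreen G C σ Vi ⟨x, hx⟩ ⟨y, hy⟩) ∧
      greenDb G σ hσsym C Vi
          ⟨(x, false), Finset.mem_product.mpr ⟨hx, Finset.mem_univ _⟩⟩
          ⟨(y, true), Finset.mem_product.mpr ⟨hy, Finset.mem_univ _⟩⟩ =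
        (1 / 2) * (twistedGreen G C (fun _ _ => 1) Vi ⟨x, hx⟩ ⟨y, hy⟩ -
          twistedGreen G C σ Vi ⟨x, hx⟩ ⟨y, hy⟩) := by
  have hVb' : ∃ b, b ∉ Vi := by
    obtain ⟨b, hb⟩ := hVb
    exact ⟨b, by simpa using hb⟩
  intro x y hx hy
  have key := greenDb_apply G hconn Vi hVb' C hCsym hCpos σ hσsym hσpm ⟨x, hx⟩ ⟨y, hy⟩ false
  constructor
  · refine (key false).trans ?_
    simp [sheetSign]
  · refine (key true).trans ?_
    simp [sheetSign, sub_eq_add_neg]
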